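/- arXiv:1701.02178 — 2 statements merged into one kernel-verified Lean document; each statement's English description precedes it below -/
import Mathlib

section
/- Let A be a finite unital F∞-algebra. If a and b are invertible elements of A with a ≤ b in the natural partial order (i.e. a + b = a), then a = b. (In particular, any two invertible elements of A are unordered.) -/
class FinfModule (M : Type*) extends Zero M, Neg M, Add M where
  add_assoc : ∀ a b c : M, a + b + c = a + (b + c)
  add_comm : ∀ a b : M, a + b = b + a
  add_idem : ∀ a : M, a + a = a
  add_neg : ∀ a : M, a + -a = 0
  neg_add : ∀ a b : M, -(a + b) = -a + -b
  neg_neg : ∀ a : M, - -a = a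

class FinfAlgebra (A : Type*) extends FinfModule A, Mul A where
  mul_assoc : ∀ a b c : A, a * b * c = a * (b * c)
  mul_zero : ∀ a : A, a * 0 = 0
  zero_mul : ∀ a : A, 0 * a = 0
  neg_mul : ∀ a b : A, -a * b = -(a * b)
  mul_neg : ∀ a b : A, a * -b = -(a * b)
  left_distrib : ∀ a b c : A, a * (b + c) = a * b + a * c
  right_distrib : ∀ a b c : A, (a + b) * c = a * c + b * c

class FinfUnitalAlgebra (A : Type*) extends FinfAlgebra A, One A where
  one_mul : ∀ a : A, 1 * a = a
  mul_one : ∀ a : A, a * 1 = a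

@[reducible] def finfMonoid (A : Type*) [FinfUnitalAlgebra A] : Monoid A where
  mul_assoc := FinfAlgebra.mul_assoc
  one_mul := FinfUnitalAlgebra.one_mul
  mul_one := FinfUnitalAlgebra.mul_one

theorem stmt0 {A : Type*} [FinfUnitalAlgebra A] [Finite A] (a b : A)
    (ha : ∃ a' : A, a * a' = 1 ∧ a' * a = 1)
    (hb : ∃ b' : A, b * b' = 1 ∧ b' * b = 1)
    (hab : a + b = a) : a = b := by
  letI := finfMonoid A
  obtain ⟨a', ha1, ha2⟩ := ha
  obtain ⟨b', hb1, hb2⟩ := hb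
  let u : Aˣ := ⟨a, a', ha1, ha2⟩
  let v : Aˣ := ⟨b, b', hb1, hb2⟩
  have hc : a * b' + 1 = a * b' := by
    rw [← hb1, ← FinfAlgebra.right_distrib, hab]
  have key : ∀ n : ℕ, (a * b') ^ (n + 1) + a * b' = (a * b') ^ (n + 1) := by
    intro n
    induction n with
    | zero => simp only [zero_add, pow_one]; exact FinfModule.add_idem _
    | succ n ih =>
      have h : (a * b') ^ (n + 1 + 1) + (a * b') ^ (n + 1) = (a * b') ^ (n + 1 + 1) := by
        have h2 := FinfAlgebra.left_distrib ((a * b') ^ (n + 1)) (a * b') 1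
        rw [hc] at h2
        rw [pow_succ _ (n + 1)]
        exact (h2.trans (by rw [FinfUnitalAlgebra.mul_one])).symm
      rw [← h, FinfModule.add_assoc, ih]
  have hu : ((u * v⁻¹ : Aˣ) : A) = a * b' := rfl
  obtain ⟨n, hn, hp⟩ := isOfFinOrder_iff_pow_eq_one.1 (isOfFinOrder_of_finite (u * v⁻¹))
  have hp' : (a * b') ^ n = 1 := by
    rw [← hu, ← Units.val_pow_eq_pow_val, hp]; rfl
  obtain ⟨m, rfl⟩ := Nat.exists_eq_succ_of_ne_zero hn.ne'
  have k := key m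
  rw [hp', FinfModule.add_comm, hc] at k
  calc a = a * (b' * b) := by rw [hb2, FinfUnitalAlgebra.mul_one]
    _ = b := by rw [← FinfAlgebra.mul_assoc, k, FinfUnitalAlgebra.one_mul]
end

section
/- Let F be an F∞-field and x ∈ F with x ≠ 1. Suppose P is a radical congruence on F with (x, 1) ∉ P which is maximal among such congruences: for every radical congruence Q on F with P ⊆ Q and (x, 1) ∉ Q one has Q = P. Then P is a prime congruence. -/
class FinfCommAlgebra (A : Type*) extends FinfUnitalAlgebra A where
  mul_comm : ∀ a b : A, a * b = b * a

structure FinfModCong (M : Type*) [FinfModule M] where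
  rel : M → M → Prop
  refl : ∀ a : M, rel a a
  symm : ∀ {a b : M}, rel a b → rel b a
  trans : ∀ {a b c : M}, rel a b → rel b c → rel a c
  add_compat : ∀ {a b : M} (c : M), rel a b → rel (a + c) (b + c)
  neg_compat : ∀ {a b : M}, rel a b → rel (-a) (-b)

structure FinfCong (A : Type*) [FinfAlgebra A] extends FinfModCong A where
  mul_compat : ∀ {a b : A} (c : A), rel a b → rel (a * c) (b * c)

def FinfProper {A : Type*} [FinfAlgebra A] (C : FinfCong A) : Prop :=
  ∃ a b : A, ¬ C.rel a b

def FinfPrime {A : Type*} [FinfAlgebra A] (C : FinfCong A) : Prop :=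
  FinfProper C ∧
  (∀ a b c d : A, C.rel (a * c + b * d) (a * d + b * c) →
      C.rel a b ∨ C.rel c d ∨ C.rel (a * c + b * d) 0 ∨ C.rel (a * d + b * c) 0) ∧
  (∀ a b c : A, C.rel (a * c) (b * c) → C.rel a b ∨ C.rel c 0)

def FinfRadical {A : Type*} [FinfAlgebra A] (C : FinfCong A) : Prop :=
  ∀ a b : A, C.rel (a * a + b * b) (a * b) →
    C.rel a b ∨ C.rel (a * a + b * b) 0 ∨ C.rel (a * b) 0

namespace Finf17

section
variable {K : Type*} [FinfCommAlgebra K]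

instance : Std.Associative (α := K) (· + ·) := ⟨FinfModule.add_assoc⟩
instance : Std.Commutative (α := K) (· + ·) := ⟨FinfModule.add_comm⟩
instance : Std.IdempotentOp (α := K) (· + ·) := ⟨FinfModule.add_idem⟩
instance : Std.Associative (α := K) (· * ·) := ⟨FinfAlgebra.mul_assoc⟩
instance : Std.Commutative (α := K) (· * ·) := ⟨FinfCommAlgebra.mul_comm⟩

theorem add_zero' (a : K) : a + 0 = 0 := by
  rw [← FinfModule.add_neg a]; ac_rfl

theorem zero_add' (a : K) : 0 + a = 0 := by
  rw [FinfModule.add_comm, add_zero']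

/-- The order of the semilattice. -/
def le (a b : K) : Prop := a + b = b

theorem le_refl' (a : K) : le a a := FinfModule.add_idem a

theorem le_trans' {a b c : K} (h : le a b) (h' : le b c) : le a c := by
  unfold le at *
  calc a + c = a + (b + c) := by rw [h']
    _ = (a + b) + c := by ac_rfl
    _ = c := by rw [h, h']

theorem le_antisymm' {a b : K} (h : le a b) (h' : le b a) : a = b := by
  unfold le at *
  rw [← h, FinfModule.add_comm, h']

theorem le_add_left' (a b : K) : le a (a + b) := by
  unfold le; ac_rfl

theorem add_le' {a b c d : K} (h : le a b) (h' : le c d) : le (a + c) (b + d) := by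
  unfold le at *
  calc a + c + (b + d) = (a + b) + (c + d) := by ac_rfl
    _ = b + d := by rw [h, h']

theorem mul_le_right' {a b : K} (c : K) (h : le a b) : le (a * c) (b * c) := by
  unfold le at *
  rw [← FinfAlgebra.right_distrib, h]

theorem neg_le' {a b : K} (h : le a b) : le (-a) (-b) := by
  unfold le at *
  rw [← FinfModule.neg_add, h]

theorem le_mul_one' {s : K} (a : K) (h : le 1 s) : le a (a * s) := by
  have := mul_le_right' a h
  rwa [FinfUnitalAlgebra.one_mul, FinfCommAlgebra.mul_comm] at this

theorem cancel (hK : ∀ a : K, a ≠ 0 → ∃ b : K, a * b = 1) {a b c : K} (hc : c ≠ 0)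
    (h : a * c = b * c) : a = b := by
  obtain ⟨d, hd⟩ := hK c hc
  have := congrArg (· * d) h
  simpa only [FinfAlgebra.mul_assoc, hd, FinfUnitalAlgebra.mul_one] using this

theorem mul_ne (hK : ∀ a : K, a ≠ 0 → ∃ b : K, a * b = 1) {a b : K} (ha : a ≠ 0) (hb : b ≠ 0) :
    a * b ≠ 0 := fun h => ha (cancel hK hb (by rw [h, FinfAlgebra.zero_mul]))

theorem le_cancel (hK : ∀ a : K, a ≠ 0 → ∃ b : K, a * b = 1) {a b c : K} (hc : c ≠ 0)
    (h : le (a * c) (b * c)) : le a b := by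
  unfold le at *
  rw [← FinfAlgebra.right_distrib] at h
  exact cancel hK hc h

/-- The congruence attached to a multiplicative set of elements above one. -/
def congOf (S : K → Prop) (h1 : S 1) (hmul : ∀ s t, S s → S t → S (s * t))
    (hS : ∀ s, S s → le 1 s) : FinfCong K where
  rel a b := ∃ s, S s ∧ le a (b * s) ∧ le b (a * s)
  refl a := ⟨1, h1, le_mul_one' a (le_refl' 1), le_mul_one' a (le_refl' 1)⟩
  symm := fun ⟨s, h, h', h''⟩ => ⟨s, h, h'', h'⟩
  trans := by
    rintro a b c ⟨s, hs, h, h'⟩ ⟨t, ht, k, k'⟩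
    refine ⟨s * t, hmul _ _ hs ht, ?_, ?_⟩
    · have := le_trans' h (mul_le_right' s k)
      have e : c * t * s = c * (s * t) := by ac_rfl
      rwa [e] at this
    · have := le_trans' k' (mul_le_right' t h')
      have e : a * s * t = a * (s * t) := by ac_rfl
      rwa [e] at this
  add_compat := by
    rintro a b c ⟨s, hs, h, h'⟩
    refine ⟨s, hs, ?_, ?_⟩
    · rw [FinfAlgebra.right_distrib]; exact add_le' h (le_mul_one' c (hS s hs))
    · rw [FinfAlgebra.right_distrib]; exact add_le' h' (le_mul_one' c (hS s hs))
  neg_compat := by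
    rintro a b ⟨s, hs, h, h'⟩
    refine ⟨s, hs, ?_, ?_⟩
    · rw [FinfAlgebra.neg_mul]; exact neg_le' h
    · rw [FinfAlgebra.neg_mul]; exact neg_le' h'
  mul_compat := by
    rintro a b c ⟨s, hs, h, h'⟩
    refine ⟨s, hs, ?_, ?_⟩
    · have e : b * c * s = b * s * c := by ac_rfl
      rw [e]; exact mul_le_right' c h
    · have e : a * c * s = a * s * c := by ac_rfl
      rw [e]; exact mul_le_right' c h'

/-- The polar of a set of elements above one. -/
def polar (T : K → Prop) (s : K) : Prop := s ≠ 0 ∧ le 1 s ∧ ∀ t, T t → s * t = s + t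

theorem polar_one (h10 : (1 : K) ≠ 0) (T : K → Prop) (hT : ∀ t, T t → le 1 t) : polar T 1 :=
  ⟨h10, le_refl' 1, fun t ht => by rw [FinfUnitalAlgebra.one_mul]; exact (hT t ht).symm⟩

theorem polar_mul (hK : ∀ a : K, a ≠ 0 → ∃ b : K, a * b = 1) (T : K → Prop) (s t : K)
    (hs : polar T s) (ht : polar T t) : polar T (s * t) := by
  refine ⟨mul_ne hK hs.1 ht.1, le_trans' hs.2.1 (le_mul_one' s ht.2.1), fun f hf => ?_⟩
  have e : s + s * t = s * t := le_mul_one' s ht.2.1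
  calc s * t * f = s * (t * f) := FinfAlgebra.mul_assoc _ _ _
    _ = s * t + s * f := by rw [ht.2.2 f hf, FinfAlgebra.left_distrib]
    _ = (s + s * t) + f := by rw [hs.2.2 f hf]; ac_rfl
    _ = s * t + f := by rw [e]

theorem disjoint_eq_one (hK : ∀ a : K, a ≠ 0 → ∃ b : K, a * b = 1) {x s t : K}
    (hs : s ≠ 0) (ht : t ≠ 0) (hst : t * s = t + s)
    (h1 : le x (1 * s)) (h2 : le 1 (x * s)) (h3 : le x (1 * t)) (h4 : le 1 (x * t)) : x = 1 := by
  have hne := mul_ne hK ht hs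
  apply le_antisymm'
  · apply le_cancel hK hne
    have := add_le' (mul_le_right' t h1) (mul_le_right' s h3)
    have e1 : x * t + x * s = x * (t * s) := by rw [hst, FinfAlgebra.left_distrib]
    have e2 : 1 * s * t + 1 * t * s = 1 * (t * s) := by ac_rfl
    rwa [e1, e2] at this
  · apply le_cancel hK hne
    have := add_le' (mul_le_right' t h2) (mul_le_right' s h4)
    have e1 : 1 * t + 1 * s = 1 * (t * s) := by rw [hst, FinfAlgebra.left_distrib]
    have e2 : x * s * t + x * t * s = x * (t * s) := by ac_rfl
    rwa [e1, e2] at this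

theorem total_aux (hK : ∀ a : K, a ≠ 0 → ∃ b : K, a * b = 1) (h10 : (1 : K) ≠ 0)
    (x : K) (hx : x ≠ 1)
    (hmax : ∀ Q : FinfCong K, ¬ Q.rel x 1 → ∀ a b : K, Q.rel a b → a = b)
    (e f : K) (he : e ≠ 0) (hf : f ≠ 0) (he1 : le 1 e) (hf1 : le 1 f) (hef : e * f = e + f) :
    e = 1 ∨ f = 1 := by
  by_contra hcon
  push Not at hcon
  obtain ⟨hne, hnf⟩ := hcon
  let S : K → Prop := polar (fun t => t = f)
  have hSe : S e := ⟨he, he1, by rintro t rfl; exact hef⟩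
  have hS1 : ∀ s, S s → le 1 s := fun s h => h.2.1
  have hTf : polar S f := by
    refine ⟨hf, hf1, fun s hs => ?_⟩
    rw [FinfCommAlgebra.mul_comm, hs.2.2 f rfl, FinfModule.add_comm]
  let Q1 := congOf S (polar_one h10 _ (by rintro t rfl; exact hf1)) (polar_mul hK _) hS1
  let Q2 := congOf (polar S) (polar_one h10 _ hS1) (polar_mul hK _) (fun s h => h.2.1)
  have k1 : Q1.rel x 1 := by
    by_contra h
    refine hne (hmax Q1 h e 1 ⟨e, hSe, ?_, le_trans' he1 (le_mul_one' e he1)⟩)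
    rw [FinfUnitalAlgebra.one_mul]; exact le_refl' e
  have k2 : Q2.rel x 1 := by
    by_contra h
    refine hnf (hmax Q2 h f 1 ⟨f, hTf, ?_, le_trans' hf1 (le_mul_one' f hf1)⟩)
    rw [FinfUnitalAlgebra.one_mul]; exact le_refl' f
  obtain ⟨s, hs, h1, h2⟩ := k1
  obtain ⟨t, ht, h3, h4⟩ := k2
  exact hx (disjoint_eq_one hK hs.1 ht.1 (ht.2.2 s hs) h1 h2 h3 h4)

theorem total (hK : ∀ a : K, a ≠ 0 → ∃ b : K, a * b = 1) (h10 : (1 : K) ≠ 0)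
    (x : K) (hx : x ≠ 1)
    (hmax : ∀ Q : FinfCong K, ¬ Q.rel x 1 → ∀ a b : K, Q.rel a b → a = b)
    (a b : K) (hab : a + b ≠ 0) : a + b = a ∨ a + b = b := by
  have ha : a ≠ 0 := by rintro rfl; exact hab (zero_add' b)
  have hb : b ≠ 0 := by rintro rfl; exact hab (add_zero' a)
  obtain ⟨a', ha'⟩ := hK a ha
  obtain ⟨b', hb'⟩ := hK b hb
  have e1 : (1 + a * b') * b = a + b := by
    have : a * b' * b = a * (b * b') := by ac_rfl
    rw [FinfAlgebra.right_distrib, this, hb', FinfUnitalAlgebra.one_mul,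
      FinfUnitalAlgebra.mul_one, FinfModule.add_comm]
  have f1 : (1 + b * a') * a = a + b := by
    have : b * a' * a = b * (a * a') := by ac_rfl
    rw [FinfAlgebra.right_distrib, this, ha', FinfUnitalAlgebra.one_mul,
      FinfUnitalAlgebra.mul_one]
  have huv : a * b' * (b * a') = 1 := by
    have : a * b' * (b * a') = (a * a') * (b * b') := by ac_rfl
    rw [this, ha', hb', FinfUnitalAlgebra.one_mul]
  have he : 1 + a * b' ≠ 0 := by
    intro h; rw [h, FinfAlgebra.zero_mul] at e1; exact hab e1.symm
  have hf : 1 + b * a' ≠ 0 := by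
    intro h; rw [h, FinfAlgebra.zero_mul] at f1; exact hab f1.symm
  have hef : (1 + a * b') * (1 + b * a') = (1 + a * b') + (1 + b * a') := by
    rw [FinfAlgebra.right_distrib, FinfAlgebra.left_distrib (a * b'), huv,
      FinfUnitalAlgebra.one_mul, FinfUnitalAlgebra.mul_one]
    ac_rfl
  rcases total_aux hK h10 x hx hmax _ _ he hf (le_add_left' _ _) (le_add_left' _ _) hef with h | h
  · right; rw [← e1, h, FinfUnitalAlgebra.one_mul]
  · left; rw [← f1, h, FinfUnitalAlgebra.one_mul]

theorem prime_aux (hK : ∀ a : K, a ≠ 0 → ∃ b : K, a * b = 1) (h10 : (1 : K) ≠ 0)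
    (x : K) (hx : x ≠ 1)
    (hmax : ∀ Q : FinfCong K, ¬ Q.rel x 1 → ∀ a b : K, Q.rel a b → a = b)
    (a b c d : K) (h : a * c + b * d = a * d + b * c) :
    a = b ∨ c = d ∨ a * c + b * d = 0 := by
  by_cases h0 : a * c + b * d = 0
  · exact Or.inr (Or.inr h0)
  have tot := total hK h10 x hx hmax
  have hp : (a + b) * (c + d) = a * c + b * d := by
    rw [FinfAlgebra.right_distrib, FinfAlgebra.left_distrib, FinfAlgebra.left_distrib]
    calc a * c + a * d + (b * c + b * d) = (a * c + b * d) + (a * d + b * c) := by ac_rfl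
      _ = _ := by rw [← h, FinfModule.add_idem]
  have hab : a + b ≠ 0 := by
    intro k; rw [k, FinfAlgebra.zero_mul] at hp; exact h0 hp.symm
  have hcd : c + d ≠ 0 := by
    intro k; rw [k, FinfAlgebra.mul_zero] at hp; exact h0 hp.symm
  have ha : a ≠ 0 := by rintro rfl; exact hab (zero_add' b)
  have hb : b ≠ 0 := by rintro rfl; exact hab (add_zero' a)
  have hc : c ≠ 0 := by rintro rfl; exact hcd (zero_add' d)
  have hd : d ≠ 0 := by rintro rfl; exact hcd (add_zero' c)
  have lc : ∀ {p q r : K}, r ≠ 0 → r * p = r * q → p = q := by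
    intro p q r hr k
    rw [FinfCommAlgebra.mul_comm r p, FinfCommAlgebra.mul_comm r q] at k
    exact cancel hK hr k
  have t1 := tot _ _ h0
  have t2 := tot _ _ (h ▸ h0)
  rw [← h] at t2
  rw [← hp] at t1 t2
  rcases tot a b hab with k | k <;> rcases tot c d hcd with l | l <;> rw [k, l] at t1 t2
  · rcases t2 with m | m
    · exact Or.inr (Or.inl (lc ha m))
    · exact Or.inl (cancel hK hc m)
  · rcases t1 with m | m
    · exact Or.inr (Or.inl (lc ha m).symm)
    · exact Or.inl (cancel hK hd m)
  · rcases t1 with m | m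
    · exact Or.inl (cancel hK hc m).symm
    · exact Or.inr (Or.inl (lc hb m))
  · rcases t2 with m | m
    · exact Or.inl (cancel hK hd m).symm
    · exact Or.inr (Or.inl (lc hb m).symm)

theorem add_compat' (C : FinfCong K) {a b c d : K} (h : C.rel a b) (k : C.rel c d) :
    C.rel (a + c) (b + d) := by
  refine C.trans (C.add_compat c h) ?_
  rw [FinfModule.add_comm b c, FinfModule.add_comm b d]
  exact C.add_compat b k

theorem mul_compat' (C : FinfCong K) {a b c d : K} (h : C.rel a b) (k : C.rel c d) :
    C.rel (a * c) (b * d) := by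
  refine C.trans (C.mul_compat c h) ?_
  rw [FinfCommAlgebra.mul_comm b c, FinfCommAlgebra.mul_comm b d]
  exact C.mul_compat b k

theorem rel_cancel (hK : ∀ a : K, a ≠ 0 → ∃ b : K, a * b = 1) (C : FinfCong K) {a b c : K}
    (hc : c ≠ 0) (h : C.rel (a * c) (b * c)) : C.rel a b := by
  obtain ⟨d, hd⟩ := hK c hc
  have := C.mul_compat d h
  simpa only [FinfAlgebra.mul_assoc, hd, FinfUnitalAlgebra.mul_one] using this

theorem radical_all (hK : ∀ a : K, a ≠ 0 → ∃ b : K, a * b = 1) (C : FinfCong K) :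
    FinfRadical C := by
  intro a b h
  by_cases ha : a = 0
  · subst ha; right; right; rw [FinfAlgebra.zero_mul]; exact C.refl _
  by_cases hb : b = 0
  · subst hb; right; right; rw [FinfAlgebra.mul_zero]; exact C.refl _
  left
  have k1 : C.rel (a + b) b := by
    apply rel_cancel hK C ha
    rw [FinfAlgebra.right_distrib, FinfCommAlgebra.mul_comm b a]
    have := add_compat' C (C.refl (a * a)) (C.symm h)
    have e : a * a + (a * a + b * b) = a * a + b * b := by ac_rfl
    rw [e] at this
    exact C.trans this h
  have k2 : C.rel (a + b) a := by
    apply rel_cancel hK C hb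
    rw [FinfAlgebra.right_distrib]
    have := add_compat' C (C.symm h) (C.refl (b * b))
    have e : (a * a + b * b) + b * b = a * a + b * b := by ac_rfl
    rw [e] at this
    exact C.trans this h
  exact C.trans (C.symm k2) k1

/-- The setoid of a congruence. -/
def setoidOf (C : FinfCong K) : Setoid K := ⟨C.rel, C.refl, C.symm, C.trans⟩

/-- The quotient algebra by a congruence. -/
def Quo (C : FinfCong K) := Quotient (setoidOf C)

/-- The projection to the quotient. -/
def mk (C : FinfCong K) (a : K) : Quo C := Quotient.mk (setoidOf C) a

theorem mk_eq (C : FinfCong K) {a b : K} : mk C a = mk C b ↔ C.rel a b :=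
  ⟨fun h => Quotient.exact (s := setoidOf C) h, fun h => Quotient.sound (s := setoidOf C) h⟩

theorem mk_surj (C : FinfCong K) (q : Quo C) : ∃ a, mk C a = q :=
  Quotient.exists_rep (s := setoidOf C) q

instance (C : FinfCong K) : Zero (Quo C) := ⟨mk C 0⟩
instance (C : FinfCong K) : One (Quo C) := ⟨mk C 1⟩
instance (C : FinfCong K) : Neg (Quo C) :=
  ⟨Quotient.map (sa := setoidOf C) (sb := setoidOf C) (fun a => -a) fun _ _ h => C.neg_compat h⟩
instance (C : FinfCong K) : Add (Quo C) :=
  ⟨Quotient.map₂ (sa := setoidOf C) (sb := setoidOf C) (sc := setoidOf C) (fun a b => a + b)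
    fun _ _ h _ _ k => add_compat' C h k⟩
instance (C : FinfCong K) : Mul (Quo C) :=
  ⟨Quotient.map₂ (sa := setoidOf C) (sb := setoidOf C) (sc := setoidOf C) (fun a b => a * b)
    fun _ _ h _ _ k => mul_compat' C h k⟩

theorem mk_zero (C : FinfCong K) : (0 : Quo C) = mk C 0 := rfl
theorem mk_one (C : FinfCong K) : (1 : Quo C) = mk C 1 := rfl
theorem mk_neg (C : FinfCong K) (a : K) : - mk C a = mk C (-a) := rfl
theorem mk_add (C : FinfCong K) (a b : K) : mk C a + mk C b = mk C (a + b) := rfl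
theorem mk_mul (C : FinfCong K) (a b : K) : mk C a * mk C b = mk C (a * b) := rfl

theorem ind1 (C : FinfCong K) {p : Quo C → Prop} (h : ∀ a, p (mk C a)) (q) : p q := by
  obtain ⟨a, rfl⟩ := mk_surj C q; exact h a

instance (C : FinfCong K) : FinfCommAlgebra (Quo C) where
  add_assoc := ind1 C fun a => ind1 C fun b => ind1 C fun c =>
    congrArg (mk C) (FinfModule.add_assoc a b c)
  add_comm := ind1 C fun a => ind1 C fun b => congrArg (mk C) (FinfModule.add_comm a b)
  add_idem := ind1 C fun a => congrArg (mk C) (FinfModule.add_idem a)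
  add_neg := ind1 C fun a => congrArg (mk C) (FinfModule.add_neg a)
  neg_add := ind1 C fun a => ind1 C fun b => congrArg (mk C) (FinfModule.neg_add a b)
  neg_neg := ind1 C fun a => congrArg (mk C) (FinfModule.neg_neg a)
  mul_assoc := ind1 C fun a => ind1 C fun b => ind1 C fun c =>
    congrArg (mk C) (FinfAlgebra.mul_assoc a b c)
  mul_zero := ind1 C fun a => congrArg (mk C) (FinfAlgebra.mul_zero a)
  zero_mul := ind1 C fun a => congrArg (mk C) (FinfAlgebra.zero_mul a)
  neg_mul := ind1 C fun a => ind1 C fun b => congrArg (mk C) (FinfAlgebra.neg_mul a b)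
  mul_neg := ind1 C fun a => ind1 C fun b => congrArg (mk C) (FinfAlgebra.mul_neg a b)
  left_distrib := ind1 C fun a => ind1 C fun b => ind1 C fun c =>
    congrArg (mk C) (FinfAlgebra.left_distrib a b c)
  right_distrib := ind1 C fun a => ind1 C fun b => ind1 C fun c =>
    congrArg (mk C) (FinfAlgebra.right_distrib a b c)
  one_mul := ind1 C fun a => congrArg (mk C) (FinfUnitalAlgebra.one_mul a)
  mul_one := ind1 C fun a => congrArg (mk C) (FinfUnitalAlgebra.mul_one a)
  mul_comm := ind1 C fun a => ind1 C fun b => congrArg (mk C) (FinfCommAlgebra.mul_comm a b)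

/-- Pulling back a congruence from the quotient. -/
def pull (C : FinfCong K) (Q : FinfCong (Quo C)) : FinfCong K where
  rel a b := Q.rel (mk C a) (mk C b)
  refl a := Q.refl _
  symm h := Q.symm h
  trans h k := Q.trans h k
  add_compat c h := Q.add_compat (mk C c) h
  neg_compat h := Q.neg_compat h
  mul_compat c h := Q.mul_compat (mk C c) h

end
end Finf17

theorem stmt17 {F : Type*} [FinfCommAlgebra F]
    (hF : ∀ a : F, a ≠ 0 → ∃ b : F, a * b = 1)
    (x : F) (hx : x ≠ 1) (P : FinfCong F) (hrad : FinfRadical P)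
    (hx1 : ¬ P.rel x 1)
    (hmax : ∀ Q : FinfCong F, FinfRadical Q → (∀ a b : F, P.rel a b → Q.rel a b) →
      ¬ Q.rel x 1 → ∀ a b : F, Q.rel a b → P.rel a b) :
    FinfPrime P := by
  refine ⟨⟨x, 1, hx1⟩, ?_, ?_⟩
  · intro a b c d h
    have hK : ∀ q : Finf17.Quo P, q ≠ 0 → ∃ r, q * r = 1 := by
      refine Finf17.ind1 P fun a ha => ?_
      obtain ⟨b, hb⟩ := hF a (by rintro rfl; exact ha rfl)
      exact ⟨Finf17.mk P b, congrArg (Finf17.mk P) hb⟩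
    have hxK : Finf17.mk P x ≠ 1 := fun h => hx1 ((Finf17.mk_eq P).1 h)
    have h10 : (1 : Finf17.Quo P) ≠ 0 := by
      intro h
      apply hxK
      rw [← FinfUnitalAlgebra.mul_one (Finf17.mk P x), h, FinfAlgebra.mul_zero]
    have hmaxK : ∀ Q : FinfCong (Finf17.Quo P), ¬ Q.rel (Finf17.mk P x) 1 →
        ∀ a b, Q.rel a b → a = b := by
      intro Q hQ
      refine Finf17.ind1 P fun a => Finf17.ind1 P fun b => fun hab => ?_
      refine (Finf17.mk_eq P).2 (hmax (Finf17.pull P Q) (Finf17.radical_all hF _) ?_ hQ a b hab)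
      intro a b k
      change Q.rel _ _
      rw [(Finf17.mk_eq P).2 k]
      exact Q.refl _
    rcases Finf17.prime_aux hK h10 _ hxK hmaxK (Finf17.mk P a) (Finf17.mk P b) (Finf17.mk P c)
      (Finf17.mk P d) ((Finf17.mk_eq P).2 h) with k | k | k
    · exact Or.inl ((Finf17.mk_eq P).1 k)
    · exact Or.inr (Or.inl ((Finf17.mk_eq P).1 k))
    · exact Or.inr (Or.inr (Or.inl ((Finf17.mk_eq P).1 k)))
  · intro a b c h
    by_cases hc : c = 0
    · subst hc; exact Or.inr (P.refl _)
    · exact Or.inl (Finf17.rel_cancel hF P hc h)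
end
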